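/- Let a, b ∈ ℝ with ab ≠ 0 and −1 ≤ a ≤ b ≤ 1, and let 𝔤 = 𝒜₄,₅^{a,b} be the 4-dimensional real Lie algebra with brackets [e₁,e₄] = e₁, [e₂,e₄] = a e₂, [e₃,e₄] = b e₃. Then for every inner product g on 𝔤 and every alternating 2-form F on 𝔤 such that (g,F) is a solution of the Einstein–Maxwell equations, the metric g is Einstein. -/

import Mathlib

open scoped BigOperators

noncomputable section

/-- The underlying vector space `ℝ⁴` of the 4-dimensional Lie algebra. -/
abbrev V4 : Type := Fin 4 → ℝ

/-- The standard basis `e₁, e₂, e₃, e₄` (0-indexed). -/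
def ee (i : Fin 4) : V4 := Pi.single i 1

/-- `g` is an inner product: a positive-definite symmetric bilinear form. -/
structure IsInnerProduct (g : V4 → V4 → ℝ) : Prop where
  symm : ∀ x y, g x y = g y x
  add_left : ∀ x y z, g (x + y) z = g x z + g y z
  smul_left : ∀ (a : ℝ) (x y : V4), g (a • x) y = a * g x y
  pos : ∀ x : V4, x ≠ 0 → 0 < g x x

/-- `F` is an alternating bilinear 2-form. -/
structure IsAltForm (F : V4 → V4 → ℝ) : Prop where
  skew : ∀ x y, F x y = - F y x
  add_left : ∀ x y z, F (x + y) z = F x z + F y z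
  smul_left : ∀ (a : ℝ) (x y : V4), F (a • x) y = a * F x y

/-- Chevalley–Eilenberg differential of a 2-form with respect to the bracket `br`:
`dF(x,y,z) = −F([x,y],z) + F([x,z],y) − F([y,z],x)`. -/
def cdiff (br : V4 → V4 → V4) (F : V4 → V4 → ℝ) (x y z : V4) : ℝ :=
  - F (br x y) z + F (br x z) y - F (br y z) x

/-- A 2-form is closed if its Chevalley–Eilenberg differential vanishes. -/
def IsClosedForm (br : V4 → V4 → V4) (F : V4 → V4 → ℝ) : Prop :=
  ∀ x y z, cdiff br F x y z = 0

/-- The Gram matrix of a bilinear form in the standard basis. -/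
def gram (g : V4 → V4 → ℝ) : Matrix (Fin 4) (Fin 4) ℝ :=
  Matrix.of fun i j => g (ee i) (ee j)

/-- The inverse Gram matrix. -/
def ginv (g : V4 → V4 → ℝ) : Matrix (Fin 4) (Fin 4) ℝ := (gram g)⁻¹

/-- The inner product induced by `g` on 2-forms:
`⟨α,β⟩ = (1/2) Σ g^{ik} g^{jl} α_{ij} β_{kl}`. -/
def formInner (g : V4 → V4 → ℝ) (α β : V4 → V4 → ℝ) : ℝ :=
  (1 / 2) * ∑ i, ∑ j, ∑ k, ∑ l,
    ginv g i k * ginv g j l * α (ee i) (ee j) * β (ee k) (ee l)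

/-- The volume form of `g` for the orientation `e¹∧e²∧e³∧e⁴`. -/
def vol (g : V4 → V4 → ℝ) (x y z w : V4) : ℝ :=
  Real.sqrt (gram g).det * Matrix.det (Matrix.of fun i j => ![x, y, z, w] i j)

/-- The wedge product of two 2-forms, as a 4-form. -/
def wedge22 (α β : V4 → V4 → ℝ) (x y z w : V4) : ℝ :=
  α x y * β z w - α x z * β y w + α x w * β y z
    + α z w * β x y - α y w * β x z + α y z * β x w

/-- `sF` is the Hodge star `⋆F` of `F` with respect to `g` and the orientation
`e¹∧e²∧e³∧e⁴`: it is the 2-form with `α ∧ sF = ⟨α,F⟩_g vol_g` for all 2-forms `α`. -/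
def IsHodgeStar (g : V4 → V4 → ℝ) (F sF : V4 → V4 → ℝ) : Prop :=
  IsAltForm sF ∧
    ∀ α : V4 → V4 → ℝ, IsAltForm α → ∀ x y z w,
      wedge22 α sF x y z w = formInner g α F * vol g x y z w

/-- `F` is co-closed: `d(⋆F) = 0`. -/
def IsCoclosed (br : V4 → V4 → V4) (g F : V4 → V4 → ℝ) : Prop :=
  ∃ sF, IsHodgeStar g F sF ∧ IsClosedForm br sF

/-- Koszul expression: `g(∇ₓy, z) = (1/2)(g([x,y],z) − g([y,z],x) + g([z,x],y))`. -/
def koszul (br : V4 → V4 → V4) (g : V4 → V4 → ℝ) (x y z : V4) : ℝ :=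
  (1 / 2) * (g (br x y) z - g (br y z) x + g (br z x) y)

/-- The Levi-Civita product `∇ₓ y`, i.e. the unique vector with
`g(∇ₓy, z) = koszul x y z` for all `z` (computed via the inverse Gram matrix). -/
def LC (br : V4 → V4 → V4) (g : V4 → V4 → ℝ) (x y : V4) : V4 :=
  fun m => ∑ k, koszul br g x y (ee k) * ginv g k m

/-- Curvature `R(x,y)z = ∇ₓ∇_y z − ∇_y∇ₓ z − ∇_{[x,y]} z`. -/
def curv (br : V4 → V4 → V4) (g : V4 → V4 → ℝ) (x y z : V4) : V4 :=
  LC br g x (LC br g y z) - LC br g y (LC br g x z) - LC br g (br x y) z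

/-- Ricci tensor `Ric(x,y) = Σᵢ g(R(vᵢ,x)y, vᵢ)` for a `g`-orthonormal basis `(vᵢ)`,
i.e. the trace of the endomorphism `z ↦ R(z,x)y`. -/
def ricci (br : V4 → V4 → V4) (g : V4 → V4 → ℝ) (x y : V4) : ℝ :=
  ∑ i, curv br g (ee i) x y i

/-- Scalar curvature: the `g`-trace of the Ricci tensor. -/
def scal (br : V4 → V4 → V4) (g : V4 → V4 → ℝ) : ℝ :=
  ∑ a, ∑ b, ginv g a b * ricci br g (ee a) (ee b)

/-- Trace-free Ricci tensor `Ric₀ = Ric − (s/4) g`. -/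
def ricci0 (br : V4 → V4 → V4) (g : V4 → V4 → ℝ) (x y : V4) : ℝ :=
  ricci br g x y - (scal br g / 4) * g x y

/-- `g` is Einstein: `Ric₀ = 0`. -/
def IsEinstein (br : V4 → V4 → V4) (g : V4 → V4 → ℝ) : Prop :=
  ∀ x y, ricci0 br g x y = 0

/-- The endomorphism `F̂` with `g(F̂x, y) = F(x,y)` (computed via the inverse Gram matrix). -/
def fhat (g F : V4 → V4 → ℝ) (x : V4) : V4 :=
  fun m => ∑ k, F x (ee k) * ginv g k m

/-- `[F∘F]₀(x,y) = g(F̂(F̂x), y) − (1/4) tr(F̂∘F̂) g(x,y)`. -/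
def FF0 (g F : V4 → V4 → ℝ) (x y : V4) : ℝ :=
  g (fhat g F (fhat g F x)) y
    - (1 / 4) * (∑ i, fhat g F (fhat g F (ee i)) i) * g x y

/-- `(g, F)` is a solution of the Einstein--Maxwell equations:
`dF = 0`, `d(⋆F) = 0`, and `Ric₀ = −[F∘F]₀`. -/
def IsEMSolution (br : V4 → V4 → V4) (g F : V4 → V4 → ℝ) : Prop :=
  IsClosedForm br F ∧ IsCoclosed br g F ∧ ∀ x y, ricci0 br g x y = - FF0 g F x y

/-- Nijenhuis tensor `N_J(x,y) = [Jx,Jy] − J[Jx,y] − J[x,Jy] − [x,y]`. -/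
def nijenhuis (br : V4 → V4 → V4) (J : V4 →ₗ[ℝ] V4) (x y : V4) : V4 :=
  br (J x) (J y) - J (br (J x) y) - J (br x (J y)) - br x y

/-- The Lie algebra `𝒜₄,₅^{a,b}`: `[e₁,e₄] = e₁`, `[e₂,e₄] = a e₂`, `[e₃,e₄] = b e₃`. -/
def brA45 (a b : ℝ) : V4 → V4 → V4 := fun x y =>
  (x 0 * y 3 - x 3 * y 0) • ee 0
    + (a * (x 1 * y 3 - x 3 * y 1)) • ee 1
    + (b * (x 2 * y 3 - x 3 * y 2)) • ee 2

theorem IsInnerProduct.isLinearMap_left {g : V4 → V4 → ℝ} (hg : IsInnerProduct g) (y : V4) :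
    IsLinearMap ℝ (fun x => g x y) :=
  ⟨fun x z => hg.add_left x z y, fun c x => hg.smul_left c x y⟩

theorem IsInnerProduct.isLinearMap_right {g : V4 → V4 → ℝ} (hg : IsInnerProduct g) (x : V4) :
    IsLinearMap ℝ (g x) :=
  ⟨fun y z => by rw [hg.symm, hg.add_left, hg.symm y, hg.symm z],
    fun c y => by rw [hg.symm, hg.smul_left, hg.symm y, smul_eq_mul]⟩

theorem IsAltForm.isLinearMap_left {F : V4 → V4 → ℝ} (hF : IsAltForm F) (y : V4) :
    IsLinearMap ℝ (fun x => F x y) :=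
  ⟨fun x z => hF.add_left x z y, fun c x => hF.smul_left c x y⟩

theorem IsAltForm.isLinearMap_right {F : V4 → V4 → ℝ} (hF : IsAltForm F) (x : V4) :
    IsLinearMap ℝ (F x) :=
  ⟨fun y z => by rw [hF.skew, hF.add_left, hF.skew y, hF.skew z]; ring,
    fun c y => by rw [hF.skew, hF.smul_left, hF.skew y, smul_eq_mul]; ring⟩

theorem IsAltForm.self_eq_zero {F : V4 → V4 → ℝ} (hF : IsAltForm F) (x : V4) : F x x = 0 := by
  linarith [hF.skew x x]

theorem IsLinearMap.map_sum_smul {W : Type*} [AddCommGroup W] [Module ℝ W] {φ : V4 → W}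
    (hφ : IsLinearMap ℝ φ) {n : ℕ} (c : Fin n → ℝ) (x : Fin n → V4) :
    φ (∑ i, c i • x i) = ∑ i, c i • φ (x i) := by
  change IsLinearMap.mk' φ hφ (∑ i, c i • x i) = ∑ i, c i • IsLinearMap.mk' φ hφ (x i)
  simp only [map_sum, IsLinearMap.mk'_apply, hφ.map_smul]

theorem sum_smul_ee (x : V4) : ∑ i, x i • ee i = x := by
  ext j
  simp [ee, Finset.sum_apply, Pi.single_apply]

theorem sum_comm_four (f : Fin 4 → Fin 4 → Fin 4 → Fin 4 → Fin 4 → ℝ) :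
    ∑ n, ∑ i, ∑ j, ∑ k, ∑ l, f n i j k l = ∑ i, ∑ j, ∑ k, ∑ l, ∑ n, f n i j k l := by
  rw [Finset.sum_comm]
  refine Finset.sum_congr rfl fun i _ => ?_
  rw [Finset.sum_comm]
  refine Finset.sum_congr rfl fun j _ => ?_
  rw [Finset.sum_comm]
  refine Finset.sum_congr rfl fun k _ => ?_
  rw [Finset.sum_comm]

theorem ee_apply (i j : Fin 4) : ee i j = if j = i then 1 else 0 := by
  simp [ee, Pi.single_apply]

/-- `v` is a `g`-orthonormal basis. -/
def IsFrame (g : V4 → V4 → ℝ) (v : Fin 4 → V4) : Prop :=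
  ∀ i j, g (v i) (v j) = if i = j then 1 else 0

namespace IsFrame

variable {g : V4 → V4 → ℝ} {v : Fin 4 → V4}

theorem matrix_mul_eq_one (hg : IsInnerProduct g) (hv : IsFrame g v) :
    Matrix.of v * (gram g * (Matrix.of v).transpose) = 1 := by
  ext i j
  have h1 : g (v i) (v j) = ∑ k, v i k * ∑ l, v j l * g (ee k) (ee l) := by
    conv_lhs => rw [← sum_smul_ee (v i), ← sum_smul_ee (v j)]
    rw [(hg.isLinearMap_left _).map_sum_smul]
    simp only [smul_eq_mul, (hg.isLinearMap_right _).map_sum_smul]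
  rw [Matrix.one_apply, ← hv i j, h1]
  simp only [Matrix.mul_apply, Matrix.of_apply, gram, Matrix.transpose_apply]
  simp only [mul_comm]

theorem ginv_eq (hg : IsInnerProduct g) (hv : IsFrame g v) (i k : Fin 4) :
    ginv g i k = ∑ m, v m i * v m k := by
  have h := mul_eq_one_comm.mp (hv.matrix_mul_eq_one hg)
  rw [Matrix.mul_assoc] at h
  rw [ginv, Matrix.inv_eq_right_inv h]
  simp [Matrix.mul_apply]

theorem det_ne_zero (hg : IsInnerProduct g) (hv : IsFrame g v) : (Matrix.of v).det ≠ 0 := by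
  intro h
  simpa [h] using congrArg Matrix.det (hv.matrix_mul_eq_one hg)

theorem det_gram_pos (hg : IsInnerProduct g) (hv : IsFrame g v) : 0 < (gram g).det := by
  have h := congrArg Matrix.det (hv.matrix_mul_eq_one hg)
  simp only [Matrix.det_mul, Matrix.det_transpose, Matrix.det_one] at h
  have h2 : 0 < (Matrix.of v).det ^ 2 := by have := hv.det_ne_zero hg; positivity
  by_contra! h3
  nlinarith

theorem eq_sum (hg : IsInnerProduct g) (hv : IsFrame g v) (x : V4) :
    x = ∑ m, g x (v m) • v m := by
  have h := mul_eq_one_comm.mp (hv.matrix_mul_eq_one hg)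
  have he : ∀ i j, ∑ m, g (ee i) (v m) * v m j = if i = j then 1 else 0 := by
    intro i j
    have h1 := congrFun (congrFun h i) j
    rw [Matrix.one_apply] at h1
    rw [← h1, Matrix.mul_apply]
    refine Finset.sum_congr rfl fun m _ => ?_
    congr 1
    conv_lhs => rw [← sum_smul_ee (v m)]
    rw [(hg.isLinearMap_right _).map_sum_smul]
    simp [Matrix.mul_apply, gram, mul_comm]
  ext j
  have h2 : ∀ m, g x (v m) = ∑ i, x i * g (ee i) (v m) := by
    intro m
    conv_lhs => rw [← sum_smul_ee x]
    rw [(hg.isLinearMap_left _).map_sum_smul]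
    rfl
  simp only [Finset.sum_apply, Pi.smul_apply, smul_eq_mul, h2, Finset.sum_mul]
  rw [Finset.sum_comm]
  simp only [mul_assoc, ← Finset.mul_sum, he]
  simp

theorem sum_ginv (hg : IsInnerProduct g) (hv : IsFrame g v) {φ : V4 → ℝ}
    (hφ : IsLinearMap ℝ φ) :
    (fun m => ∑ k, φ (ee k) * ginv g k m) = ∑ n, φ (v n) • v n := by
  ext m
  have h : ∀ n, φ (v n) = ∑ k, v n k * φ (ee k) := by
    intro n
    conv_lhs => rw [← sum_smul_ee (v n)]
    rw [hφ.map_sum_smul]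
    rfl
  simp only [hv.ginv_eq hg, Finset.mul_sum, Finset.sum_apply, Pi.smul_apply, smul_eq_mul, h,
    Finset.sum_mul]
  rw [Finset.sum_comm]
  exact Finset.sum_congr rfl fun n _ => Finset.sum_congr rfl fun k _ => by ring

theorem inner_sum (hg : IsInnerProduct g) (hv : IsFrame g v) (c : Fin 4 → ℝ) (k : Fin 4) :
    g (∑ n, c n • v n) (v k) = c k := by
  rw [(hg.isLinearMap_left _).map_sum_smul]
  simp [hv _ _]

theorem trace_eq (hg : IsInnerProduct g) (hv : IsFrame g v) {L : V4 → V4}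
    (hL : IsLinearMap ℝ L) : ∑ i, L (ee i) i = ∑ i, g (L (v i)) (v i) := by
  have h1 : ∀ i, L (ee i) i = ∑ m, g (L (ee i)) (v m) * v m i := by
    intro i
    conv_lhs => rw [hv.eq_sum hg (L (ee i))]
    simp
  have h2 : ∀ m, g (L (v m)) (v m) = ∑ i, v m i * g (L (ee i)) (v m) := by
    intro m
    have h3 : L (v m) = ∑ i, v m i • L (ee i) := by
      conv_lhs => rw [← sum_smul_ee (v m)]
      rw [hL.map_sum_smul]
    rw [h3, (hg.isLinearMap_left _).map_sum_smul]
    rfl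
  simp only [h1, h2]
  rw [Finset.sum_comm]
  exact Finset.sum_congr rfl fun n _ => Finset.sum_congr rfl fun k _ => by ring

section Form

variable {F : V4 → V4 → ℝ}

theorem fhat_eq (hg : IsInnerProduct g) (hv : IsFrame g v) (hF : IsAltForm F) (x : V4) :
    fhat g F x = ∑ n, F x (v n) • v n :=
  hv.sum_ginv hg (hF.isLinearMap_right x)

theorem inner_fhat_fhat (hg : IsInnerProduct g) (hv : IsFrame g v) (hF : IsAltForm F)
    (j k : Fin 4) :
    g (fhat g F (fhat g F (v j))) (v k) = ∑ m, F (v j) (v m) * F (v m) (v k) := by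
  rw [hv.fhat_eq hg hF (fhat g F (v j)), hv.inner_sum hg, hv.fhat_eq hg hF,
    (hF.isLinearMap_left _).map_sum_smul]
  rfl

theorem form_eq_zero (hg : IsInnerProduct g) (hv : IsFrame g v) (hF : IsAltForm F)
    (h : ∀ i j, F (v i) (v j) = 0) (x y : V4) : F x y = 0 := by
  rw [hv.eq_sum hg x, (hF.isLinearMap_left _).map_sum_smul]
  refine Finset.sum_eq_zero fun i _ => ?_
  rw [hv.eq_sum hg y, (hF.isLinearMap_right _).map_sum_smul]
  simp [h]

theorem formInner_eq (hg : IsInnerProduct g) (hv : IsFrame g v) {α : V4 → V4 → ℝ}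
    (hα : IsAltForm α) (hF : IsAltForm F) :
    formInner g α F = (1 / 2) * ∑ m, ∑ n, α (v m) (v n) * F (v m) (v n) := by
  have key : ∀ β : V4 → V4 → ℝ, IsAltForm β → ∀ m n,
      β (v m) (v n) = ∑ i, ∑ j, v m i * v n j * β (ee i) (ee j) := by
    intro β hβ m n
    conv_lhs => rw [← sum_smul_ee (v m), ← sum_smul_ee (v n)]
    rw [(hβ.isLinearMap_left _).map_sum_smul]
    simp only [smul_eq_mul, (hβ.isLinearMap_right _).map_sum_smul, Finset.mul_sum, mul_assoc]
  rw [formInner]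
  congr 1
  have hR : ∀ m n, α (v m) (v n) * F (v m) (v n) = ∑ i, ∑ j, ∑ k, ∑ l,
      v m i * v m k * (v n j * v n l) * α (ee i) (ee j) * F (ee k) (ee l) := by
    intro m n
    rw [key α hα, key F hF, Finset.sum_mul]
    refine Finset.sum_congr rfl fun i _ => ?_
    rw [Finset.sum_mul]
    refine Finset.sum_congr rfl fun j _ => ?_
    rw [Finset.mul_sum]
    refine Finset.sum_congr rfl fun k _ => ?_
    rw [Finset.mul_sum]
    exact Finset.sum_congr rfl fun l _ => by ring
  have hL : ∀ i j k l, ginv g i k * ginv g j l * α (ee i) (ee j) * F (ee k) (ee l) =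
      ∑ m, ∑ n, v m i * v m k * (v n j * v n l) * α (ee i) (ee j) * F (ee k) (ee l) := by
    intro i j k l
    rw [hv.ginv_eq hg, hv.ginv_eq hg, Finset.sum_mul_sum, Finset.sum_mul, Finset.sum_mul]
    simp only [Finset.sum_mul]
  simp only [hR, hL]
  exact ((Finset.sum_congr rfl fun m _ => sum_comm_four _).trans (sum_comm_four _)).symm

end Form

section Curvature

variable {br : V4 → V4 → V4}

/-- The structure constants of `br` in the basis `v`. -/
def str (br : V4 → V4 → V4) (g : V4 → V4 → ℝ) (v : Fin 4 → V4) (i j k : Fin 4) : ℝ :=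
  g (br (v i) (v j)) (v k)

/-- The Christoffel symbols of the Levi-Civita product in the basis `v`. -/
def chr (br : V4 → V4 → V4) (g : V4 → V4 → ℝ) (v : Fin 4 → V4) (i j k : Fin 4) : ℝ :=
  koszul br g (v i) (v j) (v k)

theorem chr_eq (i j k : Fin 4) : chr br g v i j k =
    (1 / 2) * (str br g v i j k - str br g v j k i + str br g v k i j) := rfl

theorem isLinearMap_koszul_left (hg : IsInnerProduct g) (hl : ∀ y, IsLinearMap ℝ (fun x => br x y))
    (hr : ∀ x, IsLinearMap ℝ (br x)) (y z : V4) : IsLinearMap ℝ (fun x => koszul br g x y z) := by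
  constructor
  · intro x x'
    simp only [koszul, (hl _).map_add, (hr _).map_add, (hg.isLinearMap_left _).map_add,
      (hg.isLinearMap_right _).map_add]
    ring
  · intro c x
    simp only [koszul, (hl _).map_smul, (hr _).map_smul, (hg.isLinearMap_left _).map_smul,
      (hg.isLinearMap_right _).map_smul, smul_eq_mul]
    ring

theorem isLinearMap_koszul_mid (hg : IsInnerProduct g) (hl : ∀ y, IsLinearMap ℝ (fun x => br x y))
    (hr : ∀ x, IsLinearMap ℝ (br x)) (x z : V4) : IsLinearMap ℝ (fun y => koszul br g x y z) := by
  constructor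
  · intro y y'
    simp only [koszul, (hl _).map_add, (hr _).map_add, (hg.isLinearMap_left _).map_add,
      (hg.isLinearMap_right _).map_add]
    ring
  · intro c y
    simp only [koszul, (hl _).map_smul, (hr _).map_smul, (hg.isLinearMap_left _).map_smul,
      (hg.isLinearMap_right _).map_smul, smul_eq_mul]
    ring

theorem isLinearMap_koszul_right (hg : IsInnerProduct g)
    (hl : ∀ y, IsLinearMap ℝ (fun x => br x y)) (hr : ∀ x, IsLinearMap ℝ (br x)) (x y : V4) :
    IsLinearMap ℝ (koszul br g x y) := by
  constructor
  · intro z z'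
    simp only [koszul, (hl _).map_add, (hr _).map_add, (hg.isLinearMap_left _).map_add,
      (hg.isLinearMap_right _).map_add]
    ring
  · intro c z
    simp only [koszul, (hl _).map_smul, (hr _).map_smul, (hg.isLinearMap_left _).map_smul,
      (hg.isLinearMap_right _).map_smul, smul_eq_mul]
    ring

theorem LC_eq (hg : IsInnerProduct g) (hv : IsFrame g v)
    (hl : ∀ y, IsLinearMap ℝ (fun x => br x y)) (hr : ∀ x, IsLinearMap ℝ (br x)) (x y : V4) :
    LC br g x y = ∑ n, koszul br g x y (v n) • v n :=
  hv.sum_ginv hg (isLinearMap_koszul_right hg hl hr x y)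

theorem inner_LC (hg : IsInnerProduct g) (hv : IsFrame g v)
    (hl : ∀ y, IsLinearMap ℝ (fun x => br x y)) (hr : ∀ x, IsLinearMap ℝ (br x)) (x y : V4)
    (k : Fin 4) : g (LC br g x y) (v k) = koszul br g x y (v k) := by
  rw [hv.LC_eq hg hl hr, hv.inner_sum hg]

theorem isLinearMap_LC_left (hg : IsInnerProduct g)
    (hl : ∀ y, IsLinearMap ℝ (fun x => br x y)) (hr : ∀ x, IsLinearMap ℝ (br x)) (y : V4) :
    IsLinearMap ℝ (fun x => LC br g x y) := by
  constructor
  · intro x x'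
    ext m
    simp only [LC, (isLinearMap_koszul_left hg hl hr _ _).map_add, add_mul,
      Finset.sum_add_distrib, Pi.add_apply]
  · intro c x
    ext m
    simp only [LC, (isLinearMap_koszul_left hg hl hr _ _).map_smul, smul_eq_mul, mul_assoc,
      Finset.mul_sum, Pi.smul_apply]

theorem isLinearMap_LC_right (hg : IsInnerProduct g)
    (hl : ∀ y, IsLinearMap ℝ (fun x => br x y)) (hr : ∀ x, IsLinearMap ℝ (br x)) (x : V4) :
    IsLinearMap ℝ (LC br g x) := by
  constructor
  · intro y y'
    ext m
    simp only [LC, (isLinearMap_koszul_mid hg hl hr _ _).map_add, add_mul,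
      Finset.sum_add_distrib, Pi.add_apply]
  · intro c y
    ext m
    simp only [LC, (isLinearMap_koszul_mid hg hl hr _ _).map_smul, smul_eq_mul, mul_assoc,
      Finset.mul_sum, Pi.smul_apply]

theorem isLinearMap_curv (hg : IsInnerProduct g)
    (hl : ∀ y, IsLinearMap ℝ (fun x => br x y)) (hr : ∀ x, IsLinearMap ℝ (br x)) (x y : V4) :
    IsLinearMap ℝ (fun z => curv br g z x y) := by
  constructor
  · intro z z'
    simp only [curv, (isLinearMap_LC_left hg hl hr _).map_add,
      (isLinearMap_LC_right hg hl hr _).map_add, (hl _).map_add]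
    abel
  · intro c z
    simp only [curv, (isLinearMap_LC_left hg hl hr _).map_smul,
      (isLinearMap_LC_right hg hl hr _).map_smul, (hl _).map_smul, smul_sub]

theorem ricci_eq (hg : IsInnerProduct g) (hv : IsFrame g v)
    (hl : ∀ y, IsLinearMap ℝ (fun x => br x y)) (hr : ∀ x, IsLinearMap ℝ (br x)) (j k : Fin 4) :
    ricci br g (v j) (v k) = ∑ i, ∑ m, (chr br g v j k m * chr br g v i m i
      - chr br g v i k m * chr br g v j m i - str br g v i j m * chr br g v m k i) := by
  rw [ricci, hv.trace_eq hg (isLinearMap_curv hg hl hr _ _)]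
  refine Finset.sum_congr rfl fun i _ => ?_
  have hsub : ∀ x y z, g (x - y) z = g x z - g y z :=
    fun x y z => (hg.isLinearMap_left z).map_sub x y
  have hLC : ∀ x y z, g (LC br g x (LC br g y z)) (v i) =
      ∑ m, koszul br g y z (v m) * koszul br g x (v m) (v i) := by
    intro x y z
    rw [hv.inner_LC hg hl hr, hv.LC_eq hg hl hr y z,
      (isLinearMap_koszul_mid hg hl hr _ _).map_sum_smul]
    rfl
  have hbr : g (LC br g (br (v i) (v j)) (v k)) (v i) =
      ∑ m, str br g v i j m * chr br g v m k i := by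
    rw [hv.inner_LC hg hl hr]
    conv_lhs => rw [hv.eq_sum hg (br (v i) (v j))]
    rw [(isLinearMap_koszul_left hg hl hr _ _).map_sum_smul]
    rfl
  rw [curv, hsub, hsub, hLC, hLC, hbr]
  simp only [Finset.sum_sub_distrib]
  rfl

end Curvature

end IsFrame


theorem isAltForm_wedge {g : V4 → V4 → ℝ} (hg : IsInnerProduct g) (p q : V4) :
    IsAltForm (fun x y => g x p * g y q - g x q * g y p) where
  skew x y := by ring
  add_left x y z := by simp only [hg.add_left]; ring
  smul_left c x y := by simp only [hg.smul_left]; ring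

theorem IsFrame.exists_hodge {g : V4 → V4 → ℝ} {v : Fin 4 → V4} (hg : IsInnerProduct g)
    (hv : IsFrame g v) {F s : V4 → V4 → ℝ} (hF : IsAltForm F) (hs : IsHodgeStar g F s) :
    ∃ ε : ℝ, ε ≠ 0 ∧ s (v 1) (v 2) = ε * F (v 0) (v 3) ∧ s (v 0) (v 2) = -(ε * F (v 1) (v 3)) ∧
      s (v 0) (v 1) = ε * F (v 2) (v 3) := by
  have hM : (Matrix.of fun i j => ![v 0, v 1, v 2, v 3] i j) = Matrix.of v := by
    ext i j
    fin_cases i <;> rfl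
  have h := fun i j => hs.2 _ (isAltForm_wedge hg (v i) (v j)) (v 0) (v 1) (v 2) (v 3)
  simp only [hv.formInner_eq hg (isAltForm_wedge hg _ _) hF, vol, hM, wedge22,
    Fin.sum_univ_four, hv _ _] at h
  have h03 := h 0 3
  have h13 := h 1 3
  have h23 := h 2 3
  simp [hF.self_eq_zero, hF.skew (v 3) (v 0), hF.skew (v 3) (v 1), hF.skew (v 3) (v 2)]
    at h03 h13 h23
  refine ⟨Real.sqrt (gram g).det * (Matrix.of v).det,
    mul_ne_zero (Real.sqrt_pos.2 (hv.det_gram_pos hg)).ne' (hv.det_ne_zero hg), ?_, ?_, ?_⟩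
  · rw [h03]; ring
  · linear_combination -h13
  · rw [h23]; ring

section Algebra

variable {a b : ℝ}

theorem isLinearMap_brA45_left (y : V4) : IsLinearMap ℝ (fun x => brA45 a b x y) := by
  constructor
  · intro x x'
    ext m
    simp [brA45]
    ring
  · intro c x
    ext m
    simp [brA45]
    ring

theorem isLinearMap_brA45_right (x : V4) : IsLinearMap ℝ (brA45 a b x) := by
  constructor
  · intro x x'
    ext m
    simp [brA45]
    ring
  · intro c x
    ext m
    simp [brA45]
    ring

theorem brA45_skew (x y : V4) : brA45 a b x y = -brA45 a b y x := by
  ext m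
  simp [brA45]
  ring

theorem brA45_self (x : V4) : brA45 a b x x = 0 := by
  simp [brA45, mul_comm]

theorem brA45_apply_three (x y : V4) : brA45 a b x y 3 = 0 := by
  simp [brA45, ee_apply]

theorem brA45_eq_zero {x y : V4} (hx : x 3 = 0) (hy : y 3 = 0) : brA45 a b x y = 0 := by
  simp [brA45, hx, hy]

end Algebra

/-- An orthonormal basis whose first three vectors span the abelian ideal `⟨e₁, e₂, e₃⟩`. -/
structure IsAdapted (g : V4 → V4 → ℝ) (v : Fin 4 → V4) : Prop where
  frame : IsFrame g v
  apply_three : ∀ i, i ≠ 3 → v i 3 = 0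

/-- The matrix of `x ↦ [x, v₄]` in the basis `v`. -/
def adMat (a b : ℝ) (g : V4 → V4 → ℝ) (v : Fin 4 → V4) (i j : Fin 4) : ℝ :=
  g (brA45 a b (v i) (v 3)) (v j)

namespace IsAdapted

variable {a b : ℝ} {g : V4 → V4 → ℝ} {v : Fin 4 → V4}

theorem three_three_ne_zero (hg : IsInnerProduct g) (hv : IsAdapted g v) : v 3 3 ≠ 0 := by
  intro h
  have h1 := congrFun (hv.frame.eq_sum hg (ee 3)) 3
  simp [Fin.sum_univ_four, hv.apply_three, h, ee_apply] at h1

theorem inner_three_eq_zero (hg : IsInnerProduct g) (hv : IsAdapted g v) {x : V4} (hx : x 3 = 0) :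
    g x (v 3) = 0 := by
  have h1 := congrFun (hv.frame.eq_sum hg x) 3
  simpa [Fin.sum_univ_four, hv.apply_three, hx, hv.three_three_ne_zero hg] using h1

theorem adMat_three_right (hg : IsInnerProduct g) (hv : IsAdapted g v) (i : Fin 4) :
    adMat a b g v i 3 = 0 :=
  hv.inner_three_eq_zero hg (brA45_apply_three _ _)

theorem adMat_three_left (hg : IsInnerProduct g) (j : Fin 4) : adMat a b g v 3 j = 0 := by
  rw [adMat, brA45_self, (hg.isLinearMap_left _).map_zero]

theorem brA45_eq_sum (hg : IsInnerProduct g) (hv : IsAdapted g v) (i : Fin 4) :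
    brA45 a b (v i) (v 3) = ∑ j, adMat a b g v i j • v j :=
  hv.frame.eq_sum hg _

theorem str_eq (hg : IsInnerProduct g) (hv : IsAdapted g v) (i j k : Fin 4) :
    IsFrame.str (brA45 a b) g v i j k =
      (if j = 3 then adMat a b g v i k else 0) - (if i = 3 then adMat a b g v j k else 0) := by
  rw [IsFrame.str]
  by_cases hj : j = 3
  · subst hj
    by_cases hi : i = 3
    · subst hi
      simp [brA45_self, (hg.isLinearMap_left _).map_zero]
    · simp [hi, adMat]
  · by_cases hi : i = 3
    · subst hi
      rw [brA45_skew]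
      simp [hj, adMat, (hg.isLinearMap_left _).map_neg]
    · simp [hi, hj, brA45_eq_zero (hv.apply_three i hi) (hv.apply_three j hj),
        (hg.isLinearMap_left _).map_zero]

theorem sum_adMat_self (hg : IsInnerProduct g) (hv : IsAdapted g v) :
    ∑ i, adMat a b g v i i = v 3 3 * (1 + a + b) := by
  have h := hv.frame.trace_eq hg (isLinearMap_brA45_left (a := a) (b := b) (v 3))
  simp only [adMat, ← h]
  simp [Fin.sum_univ_four, brA45, ee_apply]
  ring

theorem sum_adMat_mul (hg : IsInnerProduct g) (hv : IsAdapted g v) :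
    ∑ i, ∑ j, adMat a b g v i j * adMat a b g v j i = v 3 3 ^ 2 * (1 + a ^ 2 + b ^ 2) := by
  have hl := isLinearMap_brA45_left (a := a) (b := b) (v 3)
  have h := hv.frame.trace_eq hg (L := fun x => brA45 a b (brA45 a b x (v 3)) (v 3))
    ⟨fun x y => by simp only [hl.map_add], fun c x => by simp only [hl.map_smul]⟩
  have h2 : ∀ i, ∑ j, adMat a b g v i j * adMat a b g v j i =
      g (brA45 a b (brA45 a b (v i) (v 3)) (v 3)) (v i) := by
    intro i
    rw [hv.brA45_eq_sum hg i, hl.map_sum_smul, (hg.isLinearMap_left _).map_sum_smul]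
    rfl
  simp only [h2, ← h]
  simp [Fin.sum_univ_four, brA45, ee_apply]
  ring

theorem ricci_three (hg : IsInnerProduct g) (hv : IsAdapted g v) {j : Fin 4} (hj : j ≠ 3) :
    ricci (brA45 a b) g (v j) (v 3) = 0 := by
  rw [hv.frame.ricci_eq hg isLinearMap_brA45_left isLinearMap_brA45_right]
  have h3 := hv.adMat_three_right (a := a) (b := b) hg
  have h3' := adMat_three_left (a := a) (b := b) (v := v) hg
  fin_cases j <;>
  simp [Fin.sum_univ_four, IsFrame.chr_eq, hv.str_eq hg, h3, h3'] at hj ⊢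

theorem ricci_eq (hg : IsInnerProduct g) (hv : IsAdapted g v) {j k : Fin 4} (hj : j ≠ 3)
    (hk : k ≠ 3) : ricci (brA45 a b) g (v j) (v k) =
      -(∑ i, adMat a b g v i i) * (adMat a b g v j k + adMat a b g v k j) / 2 +
      (1 / 2) * ∑ i, (adMat a b g v i j * adMat a b g v i k -
        adMat a b g v j i * adMat a b g v k i) := by
  rw [hv.frame.ricci_eq hg isLinearMap_brA45_left isLinearMap_brA45_right]
  have h3 := hv.adMat_three_right (a := a) (b := b) hg
  have h3' := adMat_three_left (a := a) (b := b) (v := v) hg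
  fin_cases j <;> fin_cases k <;>
  simp [Fin.sum_univ_four, IsFrame.chr_eq, hv.str_eq hg, h3, h3'] at hj hk ⊢ <;> ring

end IsAdapted

theorem exists_isAdapted {g : V4 → V4 → ℝ} (hg : IsInnerProduct g) : ∃ v, IsAdapted g v := by
  have normalize : ∀ x : V4, x ≠ 0 → ∃ r : ℝ, r ≠ 0 ∧ g (r • x) (r • x) = 1 := by
    intro x hx
    have h := hg.pos x hx
    refine ⟨(Real.sqrt (g x x))⁻¹, inv_ne_zero (Real.sqrt_pos.2 h).ne', ?_⟩
    rw [hg.smul_left, (hg.isLinearMap_right x).map_smul, smul_eq_mul, ← mul_assoc, ← mul_inv,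
      Real.mul_self_sqrt h.le, inv_mul_cancel₀ h.ne']
  have hsub : ∀ x y z, g (x - y) z = g x z - g y z :=
    fun x y z => (hg.isLinearMap_left z).map_sub x y
  have hs := hg.smul_left
  have ne_zero : ∀ (x : V4) (i : Fin 4), x i = 1 → x ≠ 0 := by
    rintro x i h rfl
    simp at h
  obtain ⟨r0, hr0, n0⟩ := normalize (ee 0) (ne_zero _ 0 (by simp [ee_apply]))
  set v0 := r0 • ee 0 with hv0
  obtain ⟨r1, hr1, n1⟩ := normalize (ee 1 - g (ee 1) v0 • v0)
    (ne_zero _ 1 (by simp [ee_apply, hv0]))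
  set v1 := r1 • (ee 1 - g (ee 1) v0 • v0) with hv1
  obtain ⟨r2, hr2, n2⟩ := normalize (ee 2 - g (ee 2) v0 • v0 - g (ee 2) v1 • v1)
    (ne_zero _ 2 (by simp [ee_apply, hv0, hv1]))
  set v2 := r2 • (ee 2 - g (ee 2) v0 • v0 - g (ee 2) v1 • v1) with hv2
  obtain ⟨r3, hr3, n3⟩ := normalize
    (ee 3 - g (ee 3) v0 • v0 - g (ee 3) v1 • v1 - g (ee 3) v2 • v2)
    (ne_zero _ 3 (by simp [ee_apply, hv0, hv1, hv2]))
  set v3 := r3 • (ee 3 - g (ee 3) v0 • v0 - g (ee 3) v1 • v1 - g (ee 3) v2 • v2) with hv3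
  have o10 : g v1 v0 = 0 := by rw [hv1]; simp [hs, hsub, n0]
  have o20 : g v2 v0 = 0 := by rw [hv2]; simp [hs, hsub, n0, o10]
  have o12 : g v1 v2 = 0 := by rw [hg.symm, hv2]; simp [hs, hsub, n1, hg.symm v0 v1, o10]
  have o30 : g v3 v0 = 0 := by rw [hv3]; simp [hs, hsub, n0, o10, o20]
  have o31 : g v3 v1 = 0 := by
    rw [hv3]; simp [hs, hsub, n1, hg.symm v0 v1, hg.symm v2 v1, o10, o12]
  have o32 : g v3 v2 = 0 := by
    rw [hv3]; simp [hs, hsub, n2, hg.symm v0 v2, o12, o20]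
  refine ⟨![v0, v1, v2, v3], ?_, ?_⟩
  · intro i j
    fin_cases i <;> fin_cases j <;>
    simp [n0, n1, n2, n3, o10, o20, o12, o30, o31, o32, hg.symm v0 v1, hg.symm v0 v2,
      hg.symm v0 v3, hg.symm v1 v3, hg.symm v2 v3, hg.symm v2 v1]
  · intro i hi
    fin_cases i
    · simp [hv0, ee_apply]
    · simp [hv1, hv0, ee_apply]
    · simp [hv2, hv1, hv0, ee_apply]
    · simp at hi

theorem IsAdapted.exists_rotation {g : V4 → V4 → ℝ} {v : Fin 4 → V4} (hg : IsInnerProduct g)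
    (hv : IsAdapted g v) {p₀ p₁ p₂ : ℝ} (hp : p₀ ^ 2 + p₁ ^ 2 + p₂ ^ 2 = 1) (hp₀ : 0 ≤ p₀) :
    ∃ (v' : Fin 4 → V4) (q₀ q₁ q₂ r₀ r₁ r₂ : ℝ), IsAdapted g v' ∧
      v' 0 = p₀ • v 0 + p₁ • v 1 + p₂ • v 2 ∧ v' 1 = q₀ • v 0 + q₁ • v 1 + q₂ • v 2 ∧
      v' 2 = r₀ • v 0 + r₁ • v 1 + r₂ • v 2 ∧ v' 3 = v 3 ∧
      p₀ * q₀ + p₁ * q₁ + p₂ * q₂ = 0 ∧ p₀ * r₀ + p₁ * r₁ + p₂ * r₂ = 0 := by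
  obtain ⟨d, hd⟩ : ∃ d : ℝ, d * (1 + p₀) = 1 := ⟨(1 + p₀)⁻¹, inv_mul_cancel₀ (by positivity)⟩
  have hd' : d * (p₁ ^ 2 + p₂ ^ 2) = 1 - p₀ := by linear_combination d * hp + (1 - p₀) * hd
  obtain ⟨q₀, hq₀⟩ : ∃ x, x = -p₁ := ⟨_, rfl⟩
  obtain ⟨q₁, hq₁⟩ : ∃ x, x = 1 - p₁ ^ 2 * d := ⟨_, rfl⟩
  obtain ⟨q₂, hq₂⟩ : ∃ x, x = -(p₁ * p₂ * d) := ⟨_, rfl⟩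
  obtain ⟨r₀, hr₀⟩ : ∃ x, x = -p₂ := ⟨_, rfl⟩
  obtain ⟨r₂, hr₂⟩ : ∃ x, x = 1 - p₂ ^ 2 * d := ⟨_, rfl⟩
  have hpq : p₀ * q₀ + p₁ * q₁ + p₂ * q₂ = 0 := by
    rw [hq₀, hq₁, hq₂]; linear_combination -p₁ * hd'
  have hpr : p₀ * r₀ + p₁ * q₂ + p₂ * r₂ = 0 := by
    rw [hr₀, hq₂, hr₂]; linear_combination -p₂ * hd'
  have hqr : q₀ * r₀ + q₁ * q₂ + q₂ * r₂ = 0 := by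
    rw [hq₀, hr₀, hq₁, hq₂, hr₂]; linear_combination p₁ * p₂ * d * hd' - p₁ * p₂ * hd
  have hqq : q₀ ^ 2 + q₁ ^ 2 + q₂ ^ 2 = 1 := by
    rw [hq₀, hq₁, hq₂]; linear_combination p₁ ^ 2 * d * hd' - p₁ ^ 2 * hd
  have hrr : r₀ ^ 2 + q₂ ^ 2 + r₂ ^ 2 = 1 := by
    rw [hr₀, hq₂, hr₂]; linear_combination p₂ ^ 2 * d * hd' - p₂ ^ 2 * hd
  have hl : ∀ x y z w : V4, ∀ α β γ : ℝ, g (α • x + β • y + γ • z) w =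
      α * g x w + β * g y w + γ * g z w := by
    intro x y z w α β γ
    simp only [hg.add_left, hg.smul_left]
  have hr : ∀ x y z w : V4, ∀ α β γ : ℝ, g w (α • x + β • y + γ • z) =
      α * g w x + β * g w y + γ * g w z := by
    intro x y z w α β γ
    simp only [(hg.isLinearMap_right _).map_add, (hg.isLinearMap_right _).map_smul, smul_eq_mul]
  refine ⟨![p₀ • v 0 + p₁ • v 1 + p₂ • v 2, q₀ • v 0 + q₁ • v 1 + q₂ • v 2,
    r₀ • v 0 + q₂ • v 1 + r₂ • v 2, v 3], q₀, q₁, q₂, r₀, q₂, r₂, ⟨?_, ?_⟩, rfl, rfl, rfl, rfl,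
    hpq, hpr⟩
  · intro i j
    fin_cases i <;> fin_cases j <;> simp [hl, hr, hv.frame _ _] <;> linarith
  · intro i hi
    fin_cases i <;> simp [hv.apply_three] at hi ⊢

theorem exists_common_direction {u₀ u₁ u₂ w₀ w₁ w₂ : ℝ} (h₀ : u₁ * w₂ - u₂ * w₁ = 0)
    (h₁ : u₂ * w₀ - u₀ * w₂ = 0) (h₂ : u₀ * w₁ - u₁ * w₀ = 0)
    (hne : ¬(u₀ = 0 ∧ u₁ = 0 ∧ u₂ = 0 ∧ w₀ = 0 ∧ w₁ = 0 ∧ w₂ = 0)) :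
    ∃ p₀ p₁ p₂ α β x y : ℝ, p₀ ^ 2 + p₁ ^ 2 + p₂ ^ 2 = 1 ∧ 0 ≤ p₀ ∧
      u₀ = α * p₀ ∧ u₁ = α * p₁ ∧ u₂ = α * p₂ ∧ w₀ = β * p₀ ∧ w₁ = β * p₁ ∧ w₂ = β * p₂ ∧
      p₀ = x * u₀ + y * w₀ ∧ p₁ = x * u₁ + y * w₁ ∧ p₂ = x * u₂ + y * w₂ := by
  have normalize : ∀ x y z : ℝ, ¬(x = 0 ∧ y = 0 ∧ z = 0) →
      ∃ s : ℝ, s ≠ 0 ∧ s ^ 2 * (x ^ 2 + y ^ 2 + z ^ 2) = 1 ∧ 0 ≤ s * x := by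
    intro x y z h
    have hpos : 0 < x ^ 2 + y ^ 2 + z ^ 2 := by
      by_contra! h'
      exact h ⟨by nlinarith [sq_nonneg x, sq_nonneg y, sq_nonneg z],
        by nlinarith [sq_nonneg x, sq_nonneg y, sq_nonneg z],
        by nlinarith [sq_nonneg x, sq_nonneg y, sq_nonneg z]⟩
    set s := (Real.sqrt (x ^ 2 + y ^ 2 + z ^ 2))⁻¹ with hs
    have hs0 : 0 < s := inv_pos.2 (Real.sqrt_pos.2 hpos)
    have hs2 : s ^ 2 * (x ^ 2 + y ^ 2 + z ^ 2) = 1 := by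
      rw [hs, inv_pow, Real.sq_sqrt hpos.le, inv_mul_cancel₀ hpos.ne']
    rcases le_total 0 x with hx | hx
    · exact ⟨s, hs0.ne', hs2, by positivity⟩
    · exact ⟨-s, neg_ne_zero.2 hs0.ne', by rw [neg_sq, hs2], by nlinarith⟩
  by_cases hw : w₀ = 0 ∧ w₁ = 0 ∧ w₂ = 0
  · obtain ⟨rfl, rfl, rfl⟩ := hw
    obtain ⟨s, hs0, hs, hs'⟩ := normalize u₀ u₁ u₂ (by simpa using hne)
    refine ⟨s * u₀, s * u₁, s * u₂, s⁻¹, 0, s, 0, by linarith, hs', ?_⟩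
    simp [inv_mul_cancel_left₀ hs0]
  · obtain ⟨s, hs0, hs, hs'⟩ := normalize w₀ w₁ w₂ hw
    refine ⟨s * w₀, s * w₁, s * w₂, s * (u₀ * w₀ + u₁ * w₁ + u₂ * w₂), s⁻¹, 0, s, by linarith,
      hs', ?_, ?_, ?_, ?_⟩
    · linear_combination -u₀ * hs + s ^ 2 * w₁ * h₂ - s ^ 2 * w₂ * h₁
    · linear_combination -u₁ * hs + s ^ 2 * w₂ * h₀ - s ^ 2 * w₀ * h₂
    · linear_combination -u₂ * hs + s ^ 2 * w₀ * h₁ - s ^ 2 * w₁ * h₀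
    · simp [inv_mul_cancel_left₀ hs0]

/-- The Ricci equations in a basis whose first vector is the common direction of the electric
and magnetic fields are inconsistent. -/
theorem ricci_system_inconsistent {t x y m q r : ℝ} (ht : t ≠ 0) (hdet : 0 < m ^ 2 + q * r)
    (h₁ : x * m + y * r = 2 * t * x) (h₂ : x * q - y * m = 2 * t * y)
    (h₃ : -t * (q + r) + 2 * m * (q - r) - x * y = 0)
    (h₄ : -4 * t * m + 2 * r ^ 2 - 2 * q ^ 2 - x ^ 2 + y ^ 2 = 0) : False := by
  have key : t * ((r - q) * (x ^ 2 + y ^ 2)) = 0 := by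
    linear_combination (1 / 5) * (x * y * h₄ - (x ^ 2 - y ^ 2) * h₃ - 2 * t * (x * h₂ - y * h₁) +
      2 * (q - r) * (x * h₁ + y * h₂))
  by_cases hz : x ^ 2 + y ^ 2 = 0
  · have hx : x = 0 := by nlinarith [sq_nonneg x, sq_nonneg y]
    have hy : y = 0 := by nlinarith [sq_nonneg x, sq_nonneg y]
    subst hx hy
    have h : t * ((q + r) ^ 2 + 4 * m ^ 2) = 0 := by
      linear_combination -(q + r) * h₃ - m * h₄
    have h' : (q + r) ^ 2 + 4 * m ^ 2 = 0 := by simpa [ht] using h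
    nlinarith [sq_nonneg (q + r), sq_nonneg m, sq_nonneg r, sq_nonneg (q - r)]
  · have hqr : r = q := by
      have : r - q = 0 := by simpa [ht, hz] using key
      linarith
    subst hqr
    have hx : x * (x ^ 2 + y ^ 2 + 8 * t ^ 2) = 0 := by
      linear_combination -x * h₄ - 2 * y * h₃ - 4 * t * h₁
    have hy : y * (x ^ 2 + y ^ 2 + 8 * t ^ 2) = 0 := by
      linear_combination y * h₄ - 2 * x * h₃ - 4 * t * h₂
    have hpos : x ^ 2 + y ^ 2 + 8 * t ^ 2 ≠ 0 := by positivity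
    have hx' : x = 0 := by simpa [hpos] using hx
    have hy' : y = 0 := by simpa [hpos] using hy
    exact hz (by simp [hx', hy'])

theorem IsAdapted.sum_eq_of_isClosedForm {a b : ℝ} {g : V4 → V4 → ℝ} {v : Fin 4 → V4}
    (hg : IsInnerProduct g) (hv : IsAdapted g v) {ω : V4 → V4 → ℝ} (hω : IsAltForm ω)
    (hc : IsClosedForm (brA45 a b) ω) {i j : Fin 4} (hi : i ≠ 3) (hj : j ≠ 3) :
    ∑ k, adMat a b g v i k * ω (v k) (v j) = ∑ k, adMat a b g v j k * ω (v k) (v i) := by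
  have h := hc (v i) (v j) (v 3)
  rw [cdiff, brA45_eq_zero (hv.apply_three i hi) (hv.apply_three j hj),
    (hω.isLinearMap_left _).map_zero, hv.brA45_eq_sum hg i, hv.brA45_eq_sum hg j,
    (hω.isLinearMap_left _).map_sum_smul, (hω.isLinearMap_left _).map_sum_smul] at h
  simp only [smul_eq_mul] at h
  linarith

theorem IsFrame.exists_ricci_add_eq {br : V4 → V4 → V4} {g F : V4 → V4 → ℝ}
    (hg : IsInnerProduct g) (hF : IsAltForm F) (h : ∀ x y, ricci0 br g x y = -FF0 g F x y) :
    ∃ κ : ℝ, ∀ v, IsFrame g v → ∀ j k, ricci br g (v j) (v k) +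
      ∑ m, F (v j) (v m) * F (v m) (v k) = if j = k then κ else 0 := by
  refine ⟨scal br g / 4 + 1 / 4 * ∑ i, fhat g F (fhat g F (ee i)) i, fun v hv j k => ?_⟩
  have h1 := h (v j) (v k)
  rw [ricci0, FF0, hv.inner_fhat_fhat hg hF, hv] at h1
  split_ifs at h1 ⊢ <;> linarith

theorem isEinstein_of_form_eq_zero {br : V4 → V4 → V4} {g F : V4 → V4 → ℝ}
    (hg : IsInnerProduct g) (hF : ∀ x y, F x y = 0)
    (h : ∀ x y, ricci0 br g x y = -FF0 g F x y) : IsEinstein br g := by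
  have hz : ∀ x, fhat g F x = 0 := fun x => by
    ext m
    simp [fhat, hF]
  intro x y
  rw [h, FF0]
  simp [hz, (hg.isLinearMap_left _).map_zero]

/-- A basis in which the electric and magnetic fields both point along the first vector, which is
moreover an eigenvector of `x ↦ [x, v₄]` with eigenvalue the trace, rules out the Einstein–Maxwell
equations. -/
theorem IsAdapted.false_of_aligned {a b : ℝ} (hab : a * b ≠ 0) {g F : V4 → V4 → ℝ}
    {v : Fin 4 → V4} (hg : IsInnerProduct g) (hF : IsAltForm F) (hv : IsAdapted g v) {κ : ℝ}
    (hκ : ∀ j k, ricci (brA45 a b) g (v j) (v k) + ∑ m, F (v j) (v m) * F (v m) (v k) =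
      if j = k then κ else 0)
    (heig : brA45 a b (v 0) (v 3) = (v 3 3 * (1 + a + b)) • v 0)
    (h01 : F (v 0) (v 1) = 0) (h02 : F (v 0) (v 2) = 0) (h13 : F (v 1) (v 3) = 0)
    (h23 : F (v 2) (v 3) = 0) : False := by
  have hc := hv.three_three_ne_zero hg
  have hroot : (a + b) * (1 + b) * (1 + a) = 0 := by
    have e0 := congrFun heig 0
    have e1 := congrFun heig 1
    have e2 := congrFun heig 2
    have h3 := hv.apply_three 0 (by decide)
    simp [brA45, ee_apply, h3] at e0 e1 e2
    by_contra hne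
    have hne1 : a + b ≠ 0 := fun h => hne (by simp [h])
    have hne2 : 1 + b ≠ 0 := fun h => hne (by simp [h])
    have hne3 : 1 + a ≠ 0 := fun h => hne (by simp [h])
    have z0 : v 0 0 = 0 := by
      have : v 3 3 * (a + b) * v 0 0 = 0 := by linear_combination -e0
      simpa [hc, hne1] using this
    have z1 : v 0 1 = 0 := by
      have : v 3 3 * (1 + b) * v 0 1 = 0 := by linear_combination -e1
      simpa [hc, hne2] using this
    have z2 : v 0 2 = 0 := by
      have : v 3 3 * (1 + a) * v 0 2 = 0 := by linear_combination -e2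
      simpa [hc, hne3] using this
    have hz : v 0 = 0 := by
      ext i
      fin_cases i <;> simp [z0, z1, z2, h3]
    have h1 := hv.frame 0 0
    rw [hz, (hg.isLinearMap_left _).map_zero] at h1
    simp at h1
  obtain ⟨hs, hneg⟩ : 1 + a + b ≠ 0 ∧ a + b + a * b < 0 := by
    obtain ⟨ha, hb⟩ := mul_ne_zero_iff.1 hab
    rcases mul_eq_zero.1 hroot with h | h
    · rcases mul_eq_zero.1 h with h | h
      · obtain rfl : b = -a := by linarith
        exact ⟨by simp, by nlinarith [sq_pos_of_ne_zero ha]⟩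
      · obtain rfl : b = -1 := by linarith
        exact ⟨by simpa using ha, by linarith⟩
    · obtain rfl : a = -1 := by linarith
      exact ⟨by simpa using hb, by linarith⟩
  have hM : ∀ j, adMat a b g v 0 j = if 0 = j then v 3 3 * (1 + a + b) else 0 := by
    intro j
    rw [adMat, heig, hg.smul_left, hv.frame 0 j]
    simp
  have ht := hv.sum_adMat_self (a := a) (b := b) hg
  have hd := hv.sum_adMat_mul (a := a) (b := b) hg
  have h3 := hv.adMat_three_right (a := a) (b := b) hg
  have h3' := IsAdapted.adMat_three_left (a := a) (b := b) (v := v) hg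
  have r01 := hκ 0 1
  have r02 := hκ 0 2
  have r12 := hκ 1 2
  have r11 := hκ 1 1
  have r22 := hκ 2 2
  rw [hv.ricci_eq hg (by decide) (by decide), ht] at r01 r02 r12 r11 r22
  have m01 : adMat a b g v 0 1 = 0 := by simp [hM]
  have m02 : adMat a b g v 0 2 = 0 := by simp [hM]
  have m00 : adMat a b g v 0 0 = v 3 3 * (1 + a + b) := by simp [hM]
  have f10 : F (v 1) (v 0) = 0 := by rw [hF.skew, h01, neg_zero]
  have f20 : F (v 2) (v 0) = 0 := by rw [hF.skew, h02, neg_zero]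
  have f31 : F (v 3) (v 1) = 0 := by rw [hF.skew, h13, neg_zero]
  have f32 : F (v 3) (v 2) = 0 := by rw [hF.skew, h23, neg_zero]
  simp only [Fin.sum_univ_four, m00, m01, m02, h3, h3'] at ht hd
  simp [Fin.sum_univ_four, m00, m01, m02, h3, h3', h01, h02, h13, h23, f10, f20, f31, f32,
    hF.self_eq_zero] at r01 r02 r12 r11 r22
  have m22 : adMat a b g v 2 2 = -adMat a b g v 1 1 := by linarith
  rw [m22] at r02 r12 hd
  set t := v 3 3 * (1 + a + b) with htdef
  refine ricci_system_inconsistent (t := t) (x := adMat a b g v 1 0) (y := adMat a b g v 2 0)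
    (m := adMat a b g v 1 1) (q := adMat a b g v 1 2) (r := adMat a b g v 2 1)
    (mul_ne_zero hc hs) ?_ (by linarith) (by linarith) (by linarith) ?_
  · have : adMat a b g v 1 1 ^ 2 + adMat a b g v 1 2 * adMat a b g v 2 1 =
        -(v 3 3 ^ 2 * (a + b + a * b)) := by
      rw [htdef] at hd
      linear_combination hd / 2
    rw [this]
    have := mul_pos (sq_pos_of_ne_zero hc) (neg_pos.2 hneg)
    linarith
  · linear_combination 2 * r11 - 2 * r22 - 2 * t * m22

/-- `𝒜₄,₅^{a,b}` (`ab ≠ 0`, `−1 ≤ a ≤ b ≤ 1`) admits no left-invariant non-Einstein solution to the Einstein--Maxwell equations. -/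
theorem stmt11 (a b : ℝ) (hab : a * b ≠ 0) (h1 : -1 ≤ a) (h2 : a ≤ b) (h3 : b ≤ 1) :
    ∀ g F : V4 → V4 → ℝ, IsInnerProduct g → IsAltForm F →
      IsEMSolution (brA45 a b) g F → IsEinstein (brA45 a b) g := by
  intro g F hg hF ⟨hFc, ⟨s, hs, hsc⟩, hR⟩
  obtain ⟨κ, hκ⟩ := IsFrame.exists_ricci_add_eq hg hF hR
  obtain ⟨v, hv⟩ := exists_isAdapted hg
  have skew := hF.skew
  by_cases hne : F (v 0) (v 3) = 0 ∧ F (v 1) (v 3) = 0 ∧ F (v 2) (v 3) = 0 ∧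
      F (v 1) (v 2) = 0 ∧ -F (v 0) (v 2) = 0 ∧ F (v 0) (v 1) = 0
  · obtain ⟨h03, h13, h23, h12, h02, h01⟩ := hne
    rw [neg_eq_zero] at h02
    refine isEinstein_of_form_eq_zero hg (hv.frame.form_eq_zero hg hF fun i j => ?_) hR
    fin_cases i <;> fin_cases j <;>
    simp [hF.self_eq_zero, h01, h02, h03, h12, h13, h23, skew (v 1) (v 0), skew (v 2) (v 0),
      skew (v 3) (v 0), skew (v 2) (v 1), skew (v 3) (v 1), skew (v 3) (v 2)]
  exfalso
  have s10 := skew (v 1) (v 0)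
  have s20 := skew (v 2) (v 0)
  have s21 := skew (v 2) (v 1)
  have hp0 := hκ v hv.frame 0 3
  have hp1 := hκ v hv.frame 1 3
  have hp2 := hκ v hv.frame 2 3
  rw [hv.ricci_three hg (by decide)] at hp0 hp1 hp2
  simp [Fin.sum_univ_four, hF.self_eq_zero, s10, s20, s21] at hp0 hp1 hp2
  obtain ⟨p₀, p₁, p₂, α, β, x, y, hp, hp₀, u0, u1, u2, w0, w1, w2, c0, c1, c2⟩ :=
    exists_common_direction (by linarith) (by linarith) (by linarith) hne
  obtain ⟨ε, hε, e12, e02, e01⟩ := hv.frame.exists_hodge hg hF hs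
  have t10 := hs.1.skew (v 1) (v 0)
  have t20 := hs.1.skew (v 2) (v 0)
  have t21 := hs.1.skew (v 2) (v 1)
  have ht := hv.sum_adMat_self (a := a) (b := b) hg
  have h3 := hv.adMat_three_right (a := a) (b := b) hg
  have closed : ∀ ω, IsAltForm ω → IsClosedForm (brA45 a b) ω → _ := fun ω hω hc =>
    And.intro (hv.sum_eq_of_isClosedForm hg hω hc (i := 0) (j := 1) (by decide) (by decide))
      (And.intro
        (hv.sum_eq_of_isClosedForm hg hω hc (i := 0) (j := 2) (by decide) (by decide))
        (hv.sum_eq_of_isClosedForm hg hω hc (i := 1) (j := 2) (by decide) (by decide)))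
  obtain ⟨F01, F02, F12⟩ := closed F hF hFc
  obtain ⟨S01, S02, S12⟩ := closed s hs.1 hsc
  simp only [Fin.sum_univ_four, h3, hF.self_eq_zero, hs.1.self_eq_zero, s10, s20, s21, t10,
    t20, t21, e12, e02, e01] at ht F01 F02 F12 S01 S02 S12
  set M := adMat a b g v with hMdef
  set t := v 3 3 * (1 + a + b) with htdef
  -- the magnetic and electric fields are eigenvectors with eigenvalue the trace
  have S01' : M 0 0 * F (v 2) (v 3) + M 1 1 * F (v 2) (v 3) = M 0 2 * F (v 0) (v 3) +
      M 1 2 * F (v 1) (v 3) := mul_left_cancel₀ hε (by linarith)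
  have S02' : -(M 0 0 * F (v 1) (v 3)) + M 0 1 * F (v 0) (v 3) =
      -(M 2 1 * F (v 2) (v 3)) + M 2 2 * F (v 1) (v 3) := mul_left_cancel₀ hε (by linarith)
  have S12' : M 1 0 * F (v 1) (v 3) + M 2 0 * F (v 2) (v 3) =
      M 1 1 * F (v 0) (v 3) + M 2 2 * F (v 0) (v 3) := mul_left_cancel₀ hε (by linarith)
  have E0 : p₀ * M 0 0 + p₁ * M 1 0 + p₂ * M 2 0 = t * p₀ := by
    rw [c0, c1, c2, ← ht]
    linear_combination x * S12' - y * F12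
  have E1 : p₀ * M 0 1 + p₁ * M 1 1 + p₂ * M 2 1 = t * p₁ := by
    rw [c0, c1, c2, ← ht]
    linear_combination x * S02' + y * F02
  have E2 : p₀ * M 0 2 + p₁ * M 1 2 + p₂ * M 2 2 = t * p₂ := by
    rw [c0, c1, c2, ← ht]
    linear_combination -x * S01' - y * F01
  obtain ⟨v', q₀, q₁, q₂, r₀, r₁, r₂, hv', hv0, hv1, hv2, hv3, hq, hr⟩ :=
    hv.exists_rotation hg hp hp₀
  have hl : ∀ x y z w : V4, ∀ α β γ : ℝ, F (α • x + β • y + γ • z) w =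
      α * F x w + β * F y w + γ * F z w := by
    intro x y z w α β γ
    simp only [hF.add_left, hF.smul_left]
  have hr' : ∀ x y z w : V4, ∀ α β γ : ℝ, F w (α • x + β • y + γ • z) =
      α * F w x + β * F w y + γ * F w z := by
    intro x y z w α β γ
    simp only [(hF.isLinearMap_right _).map_add, (hF.isLinearMap_right _).map_smul, smul_eq_mul]
  have w1' : F (v 0) (v 2) = -(β * p₁) := by linarith
  refine hv'.false_of_aligned hab hg hF (hκ v' hv'.frame) ?_ ?_ ?_ ?_ ?_
  · have hL := isLinearMap_brA45_left (a := a) (b := b) (v 3)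
    rw [hv3, hv0, hL.map_add, hL.map_add, hL.map_smul, hL.map_smul, hL.map_smul,
      hv.brA45_eq_sum hg, hv.brA45_eq_sum hg, hv.brA45_eq_sum hg, ← htdef, ← hMdef]
    simp only [Fin.sum_univ_four, h3]
    ext i
    simp only [Pi.add_apply, Pi.smul_apply, smul_eq_mul]
    linear_combination v 0 i * E0 + v 1 i * E1 + v 2 i * E2
  · rw [hv0, hv1, hl]
    simp only [hr', hF.self_eq_zero, s10, s20, s21, w0, w1', w2]
    ring
  · rw [hv0, hv2, hl]
    simp only [hr', hF.self_eq_zero, s10, s20, s21, w0, w1', w2]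
    ring
  · rw [hv1, hv3, hl, u0, u1, u2]
    linear_combination α * hq
  · rw [hv2, hv3, hl, u0, u1, u2]
    linear_combination α * hr
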